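/- arXiv:2002.06265 — 4 statements merged into one kernel-verified Lean document; each statement's English description precedes it below -/
import Mathlib

section
/- Let S be a string, let q ≥ 3 be a natural number, and let i, j be indices of characters in S$. Then there are at most 12·(1 + 3q/log₂q)·log₂|S| different maximal pairs (n_k, m_k, l_k) of S such that for all k: (a) the corresponding maximal repeat S[n_k..n_k+l_k−1] is not a fractional power with exponent ≥ 2q; (b) i ∈ [n_k, n_k+l_k]; and (c) j ∈ [m_k, m_k+l_k]. -/
variable {α : Type*}

/-- Character at 1-based position `i` of `S`; the sentinel `dollar` outside `[1, |S|]`,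
in particular `S[0] = $` and `S[|S|+1] = $`. -/
def chr (dollar : α) (S : List α) (i : ℕ) : α :=
  if h : 1 ≤ i ∧ i ≤ S.length then S.get ⟨i - 1, by omega⟩ else dollar

/-- The substring `S[i..j]` (as a list), using the sentinel convention. -/
def substr (dollar : α) (S : List α) (i j : ℕ) : List α :=
  (List.range (j + 1 - i)).map (fun k => chr dollar S (i + k))

/-- `Δ` is a period of `T`: `Δ ≥ 1` and characters at distance `Δ` coincide. -/
def IsPeriodOf (Δ : ℕ) (T : List α) : Prop :=
  1 ≤ Δ ∧ ∀ (k : ℕ) (h : k + Δ < T.length), T.get ⟨k, by omega⟩ = T.get ⟨k + Δ, h⟩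

/-- The minimal period length of `T`. -/
noncomputable def minPeriod (T : List α) : ℕ := sInf {Δ | IsPeriodOf Δ T}

/-- `T` is a fractional power with exponent ≥ `q`: its minimal period `Δ` satisfies `|T| ≥ q·Δ`. -/
def IsFracPowGe (q : ℕ) (T : List α) : Prop := q * minPeriod T ≤ T.length

/-- `(n, m, l)` is a maximal pair of `S` (`l ≥ 1`, both occurrences inside `S`,
equal as strings, different preceding characters, different succeeding characters). -/
def IsMaximalPair (dollar : α) (S : List α) (n m l : ℕ) : Prop :=
  1 ≤ l ∧ 1 ≤ n ∧ 1 ≤ m ∧ n + l - 1 ≤ S.length ∧ m + l - 1 ≤ S.length ∧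
  (∀ k < l, chr dollar S (n + k) = chr dollar S (m + k)) ∧
  chr dollar S (n - 1) ≠ chr dollar S (m - 1) ∧
  chr dollar S (n + l) ≠ chr dollar S (m + l)

/-- The two maximal pairs `p`, `p'` of `S` are copies of each other: the unordered pairs of
padded occurrence strings `{S[n-1..n+l], S[m-1..m+l]}` coincide. -/
def CopiesMP (dollar : α) (S : List α) (p p' : ℕ × ℕ × ℕ) : Prop :=
  ({substr dollar S (p.1 - 1) (p.1 + p.2.2), substr dollar S (p.2.1 - 1) (p.2.1 + p.2.2)} :
      Set (List α)) =
  ({substr dollar S (p'.1 - 1) (p'.1 + p'.2.2), substr dollar S (p'.2.1 - 1) (p'.2.1 + p'.2.2)} :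
      Set (List α))

/-- `P` occurs at least twice in `T` (occurrences may overlap). -/
def OccursTwiceIn (P T : List α) : Prop :=
  ∃ p₁ p₂ : ℕ, p₁ < p₂ ∧ p₂ + P.length ≤ T.length ∧ P <+: T.drop p₁ ∧ P <+: T.drop p₂

/-- `L` is the (self-referential) LZ77-decomposition of `S`: each factor is either a fresh
single character, or the longest prefix of the remaining suffix occurring at least twice in
the text up to (and including) this factor. -/
def IsLZ77 (S : List α) (L : List (List α)) : Prop :=
  S = L.flatten ∧
  ∀ (i : ℕ) (h : i < L.length),
    L.get ⟨i, h⟩ ≠ [] ∧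
    ((∃ c : α, L.get ⟨i, h⟩ = [c] ∧ c ∉ (L.take i).flatten) ∨
     (OccursTwiceIn (L.get ⟨i, h⟩) ((L.take i).flatten ++ L.get ⟨i, h⟩) ∧
      ∀ F' : List α, F' <+: S.drop ((L.take i).flatten).length →
        OccursTwiceIn F' ((L.take i).flatten ++ F') → F'.length ≤ (L.get ⟨i, h⟩).length))

/-- The cyclic rotation of `S$` by `k`. -/
def rot (dollar : α) (S : List α) (k : ℕ) : List α :=
  (S ++ [dollar]).drop k ++ (S ++ [dollar]).take k

/-- `π` enumerates (1-based, for `i = 1, …, |S|+1`) the cyclic rotations of `S$`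
in lexicographic order; the BWT of `S` is then `i ↦ S[π i]`. -/
def IsBWTPerm [LinearOrder α] (dollar : α) (S : List α) (π : ℕ → ℕ) : Prop :=
  (∀ i, 1 ≤ i → i ≤ S.length + 1 → π i ≤ S.length) ∧
  (∀ i j, 1 ≤ i → i < j → j ≤ S.length + 1 →
    List.Lex (· < ·) (rot dollar S (π i)) (rot dollar S (π j)))

/-- Number of occurrences of `P` in `T`. -/
def occCount [DecidableEq α] (P T : List α) : ℕ :=
  ((Finset.range (T.length + 1)).filter
    (fun p => p + P.length ≤ T.length ∧ P <+: T.drop p)).card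

/-- `P` is a maximal repeat of `S`: nonempty, occurs at least twice, and every one-character
extension occurs strictly fewer times. -/
def IsMaximalRepeat [DecidableEq α] (S P : List α) : Prop :=
  P ≠ [] ∧ 2 ≤ occCount P S ∧
  (∀ c : α, occCount (c :: P) S < occCount P S) ∧
  (∀ c : α, occCount (P ++ [c]) S < occCount P S)

/-- `u` is primitive: not expressible as `v^k` with `k ≥ 2`. -/
def Primitive (u : List α) : Prop :=
  ∀ (v : List α) (k : ℕ), 2 ≤ k → u ≠ (List.replicate k v).flatten

/-- `(l', r')` is the maximal `Δ`-periodic extension of the occurrence `S[l..r]`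
(the padded maximal `Δ`-periodic extension is then `(l'-1, r'+1)`). -/
def IsMaxPerExt (dollar : α) (S : List α) (Δ l r l' r' : ℕ) : Prop :=
  1 ≤ l' ∧ l' ≤ l ∧ l ≤ r ∧ r ≤ r' ∧ r' ≤ S.length ∧ Δ ≤ r + 1 - l ∧
  IsPeriodOf Δ (substr dollar S l' r') ∧
  ¬ IsPeriodOf Δ (substr dollar S (l' - 1) r') ∧
  ¬ IsPeriodOf Δ (substr dollar S l' (r' + 1))

/-- The maximal periodic extension (w.r.t. the minimal period length) of the occurrence
`S[l..r]` adds at most one period length of additional characters. -/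
def ShortExt (dollar : α) (S : List α) (l r : ℕ) : Prop :=
  ∃ l' r', IsMaxPerExt dollar S (minPeriod (substr dollar S l r)) l r l' r' ∧
    (l - l') + (r' - r) ≤ minPeriod (substr dollar S l r)

/-- `u` on `[-δ - c, b)` coincides with `v` shifted by `δ`, and every period `Δ` of `u` on that
interval has less than `2 * q` repetitions in it. -/
structure IsShiftMatch (q : ℕ) (u v : ℤ → α) (δ c b : ℤ) : Prop where
  shift_nonneg : 0 ≤ δ
  left_nonneg : 0 ≤ c
  right_nonneg : 0 ≤ b
  eq_shift : ∀ x, -δ - c ≤ x → x < b → u x = v (x + δ)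
  lt_of_period : ∀ Δ : ℤ, 1 ≤ Δ → (∀ x, -δ - c ≤ x → x + Δ < b → u x = u (x + Δ)) →
    c + δ + b < 2 * q * Δ

namespace IsShiftMatch

variable {q : ℕ} {u v : ℤ → α} {δ c b δ₁ c₁ b₁ δ₂ c₂ b₂ δ₃ c₃ b₃ W Δ : ℤ}

theorem reverse (h : IsShiftMatch q u v δ c b) :
    IsShiftMatch q (fun x => v (-1 - x)) (fun x => u (-1 - x)) δ b c where
  shift_nonneg := h.shift_nonneg
  left_nonneg := h.right_nonneg
  right_nonneg := h.left_nonneg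
  eq_shift x hx hx' := by
    have := h.eq_shift (-1 - (x + δ)) (by lia) (by lia)
    simp only [this]
    congr 1
    ring
  lt_of_period Δ hΔ hper := by
    have := h.lt_of_period Δ hΔ fun x hx hx' => by
      have h₁ := hper (-1 - (x + δ + Δ)) (by lia) (by lia)
      rw [h.eq_shift x hx (by lia), h.eq_shift (x + Δ) (by lia) hx']
      convert h₁.symm using 2 <;> ring
    lia

/-- Two matches with different shifts force a period on their common window. -/
theorem period_of_lt (h₁ : IsShiftMatch q u v δ₁ c₁ b₁) (h₂ : IsShiftMatch q u v δ₂ c₂ b₂)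
    (hlt : δ₁ < δ₂) (hW₁ : W ≤ δ₁ + c₁) (hW₂ : W ≤ δ₂ + c₂) (x : ℤ) (hx : -W ≤ x)
    (hx' : x + (δ₂ - δ₁) < 0) : u x = u (x + (δ₂ - δ₁)) := by
  have hb₁ := h₁.right_nonneg
  have hb₂ := h₂.right_nonneg
  rw [h₂.eq_shift x (by lia) (by lia), h₁.eq_shift (x + (δ₂ - δ₁)) (by lia) (by lia)]
  congr 1
  ring

theorem not_right_break_of_lt (h₁ : IsShiftMatch q u v δ₁ c₁ b₁)
    (h₂ : IsShiftMatch q u v δ₂ c₂ b₂) (hΔ : 1 ≤ Δ)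
    (hW₁ : W ≤ δ₁ + c₁) (hW₂ : W ≤ δ₂ + c₂) (hlt : δ₁ < δ₂) (hgap : δ₂ - δ₁ + Δ ≤ W)
    (hper : ∀ x, -W ≤ x → x + Δ < 0 → u x = u (x + Δ))
    (e₁ : ∃ y, -Δ ≤ y ∧ y + Δ < b₁ ∧ u y ≠ u (y + Δ))
    (e₂ : ∃ y, -Δ ≤ y ∧ y + Δ < b₂ ∧ u y ≠ u (y + Δ)) : False := by
  obtain ⟨y₁, hy₁, hyb₁, hne₁⟩ := e₁
  obtain ⟨y₂, hy₂, hyb₂, hne₂⟩ := e₂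
  obtain ⟨y, ⟨hy, hne⟩, hmin⟩ := Int.exists_least_of_bdd
    (P := fun y => -Δ ≤ y ∧ u y ≠ u (y + Δ)) ⟨-Δ, fun z hz => hz.1⟩ ⟨y₁, hy₁, hne₁⟩
  have hyy₁ := hmin y₁ ⟨hy₁, hne₁⟩
  have hyy₂ := hmin y₂ ⟨hy₂, hne₂⟩
  have hne' : u (y + δ₁ - δ₂) ≠ u (y + δ₁ - δ₂ + Δ) := by
    rw [h₂.eq_shift (y + δ₁ - δ₂) (by lia) (by lia),
      h₂.eq_shift (y + δ₁ - δ₂ + Δ) (by lia) (by lia)]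
    rw [h₁.eq_shift y (by lia) (by lia), h₁.eq_shift (y + Δ) (by lia) (by lia)] at hne
    convert hne using 2 <;> ring_nf
  rcases lt_or_ge (y + δ₁ - δ₂) (-Δ) with hx | hx
  · exact hne' (hper _ (by lia) (by lia))
  · have := hmin _ ⟨hx, hne'⟩
    lia

theorem not_left_break_of_lt (h₁ : IsShiftMatch q u v δ₁ c₁ b₁)
    (h₂ : IsShiftMatch q u v δ₂ c₂ b₂) (hΔ : 1 ≤ Δ)
    (hlt : δ₁ < δ₂) (hgap : δ₂ - δ₁ + Δ ≤ W)
    (hper : ∀ x, -W ≤ x → x + Δ < 0 → u x = u (x + Δ))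
    (e₁ : ∃ y, -δ₁ - c₁ ≤ y ∧ y < -W ∧ u y ≠ u (y + Δ))
    (e₂ : ∃ y, -δ₂ - c₂ ≤ y ∧ y < -W ∧ u y ≠ u (y + Δ)) : False := by
  have hb₁ := h₁.right_nonneg
  have hb₂ := h₂.right_nonneg
  obtain ⟨y₁, hy₁, hyb₁, hne₁⟩ := e₁
  obtain ⟨y₂, hy₂, hyb₂, hne₂⟩ := e₂
  obtain ⟨y, ⟨hy, hne⟩, hmax⟩ := Int.exists_greatest_of_bdd
    (P := fun y => y < -W ∧ u y ≠ u (y + Δ)) ⟨-W, fun z hz => hz.1.le⟩ ⟨y₁, hyb₁, hne₁⟩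
  have hyy₁ := hmax y₁ ⟨hyb₁, hne₁⟩
  have hyy₂ := hmax y₂ ⟨hyb₂, hne₂⟩
  have hne' : u (y + δ₂ - δ₁) ≠ u (y + δ₂ - δ₁ + Δ) := by
    rw [h₁.eq_shift (y + δ₂ - δ₁) (by lia) (by lia),
      h₁.eq_shift (y + δ₂ - δ₁ + Δ) (by lia) (by lia)]
    rw [h₂.eq_shift y (by lia) (by lia), h₂.eq_shift (y + Δ) (by lia) (by lia)] at hne
    convert hne using 2 <;> ring_nf
  rcases lt_or_ge (y + δ₂ - δ₁) (-W) with hx | hx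
  · have := hmax _ ⟨hx, hne'⟩
    lia
  · exact hne' (hper _ hx (by lia))

theorem not_right_break (h₁ : IsShiftMatch q u v δ₁ c₁ b₁)
    (h₂ : IsShiftMatch q u v δ₂ c₂ b₂) (hΔ : 1 ≤ Δ)
    (hW₁ : W ≤ δ₁ + c₁) (hW₂ : W ≤ δ₂ + c₂) (hne : δ₁ ≠ δ₂) (hgap : |δ₁ - δ₂| + Δ ≤ W)
    (hper : ∀ x, -W ≤ x → x + Δ < 0 → u x = u (x + Δ))
    (e₁ : ∃ y, -Δ ≤ y ∧ y + Δ < b₁ ∧ u y ≠ u (y + Δ))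
    (e₂ : ∃ y, -Δ ≤ y ∧ y + Δ < b₂ ∧ u y ≠ u (y + Δ)) : False := by
  have ha := abs_le.1 (le_sub_iff_add_le.2 hgap)
  rcases lt_or_gt_of_ne hne with hlt | hlt
  · exact h₁.not_right_break_of_lt h₂ hΔ hW₁ hW₂ hlt (by lia) hper e₁ e₂
  · exact h₂.not_right_break_of_lt h₁ hΔ hW₂ hW₁ hlt (by lia) hper e₂ e₁

theorem not_left_break (h₁ : IsShiftMatch q u v δ₁ c₁ b₁)
    (h₂ : IsShiftMatch q u v δ₂ c₂ b₂) (hΔ : 1 ≤ Δ)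
    (hne : δ₁ ≠ δ₂) (hgap : |δ₁ - δ₂| + Δ ≤ W)
    (hper : ∀ x, -W ≤ x → x + Δ < 0 → u x = u (x + Δ))
    (e₁ : ∃ y, -δ₁ - c₁ ≤ y ∧ y < -W ∧ u y ≠ u (y + Δ))
    (e₂ : ∃ y, -δ₂ - c₂ ≤ y ∧ y < -W ∧ u y ≠ u (y + Δ)) : False := by
  have ha := abs_le.1 (le_sub_iff_add_le.2 hgap)
  rcases lt_or_gt_of_ne hne with hlt | hlt
  · exact h₁.not_left_break_of_lt h₂ hΔ hlt (by lia) hper e₁ e₂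
  · exact h₂.not_left_break_of_lt h₁ hΔ hlt (by lia) hper e₂ e₁

theorem length_lt_or_break (h : IsShiftMatch q u v δ c b) (hΔ : 1 ≤ Δ)
    (hper : ∀ x, -W ≤ x → x + Δ < 0 → u x = u (x + Δ)) :
    c + δ + b < 2 * q * Δ ∨ (∃ y, -Δ ≤ y ∧ y + Δ < b ∧ u y ≠ u (y + Δ)) ∨
      ∃ y, -δ - c ≤ y ∧ y < -W ∧ u y ≠ u (y + Δ) := by
  by_contra! hcon
  obtain ⟨hlen, hright, hleft⟩ := hcon
  refine hlen.not_gt (h.lt_of_period Δ hΔ fun x hx hx' => ?_)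
  rcases le_or_gt (-Δ) x with h₁ | h₁
  · exact hright x h₁ hx'
  rcases lt_or_ge x (-W) with h₂ | h₂
  · exact hleft x hx h₂
  · exact hper x h₂ (by lia)

/-- Among three matches with close shifts and a periodic common window, one is periodic. -/
theorem exists_length_lt (h₁ : IsShiftMatch q u v δ₁ c₁ b₁)
    (h₂ : IsShiftMatch q u v δ₂ c₂ b₂) (h₃ : IsShiftMatch q u v δ₃ c₃ b₃) (hΔ : 1 ≤ Δ)
    (hW₁ : W ≤ δ₁ + c₁) (hW₂ : W ≤ δ₂ + c₂) (hW₃ : W ≤ δ₃ + c₃)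
    (hne₁₂ : δ₁ ≠ δ₂) (hne₁₃ : δ₁ ≠ δ₃) (hne₂₃ : δ₂ ≠ δ₃)
    (hgap₁₂ : |δ₁ - δ₂| + Δ ≤ W) (hgap₁₃ : |δ₁ - δ₃| + Δ ≤ W) (hgap₂₃ : |δ₂ - δ₃| + Δ ≤ W)
    (hper : ∀ x, -W ≤ x → x + Δ < 0 → u x = u (x + Δ)) :
    c₁ + δ₁ + b₁ < 2 * q * Δ ∨ c₂ + δ₂ + b₂ < 2 * q * Δ ∨ c₃ + δ₃ + b₃ < 2 * q * Δ := by
  have r₁₂ := h₁.not_right_break h₂ hΔ hW₁ hW₂ hne₁₂ hgap₁₂ hper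
  have r₁₃ := h₁.not_right_break h₃ hΔ hW₁ hW₃ hne₁₃ hgap₁₃ hper
  have r₂₃ := h₂.not_right_break h₃ hΔ hW₂ hW₃ hne₂₃ hgap₂₃ hper
  have l₁₂ := h₁.not_left_break h₂ hΔ hne₁₂ hgap₁₂ hper
  have l₁₃ := h₁.not_left_break h₃ hΔ hne₁₃ hgap₁₃ hper
  have l₂₃ := h₂.not_left_break h₃ hΔ hne₂₃ hgap₂₃ hper
  have o₁ := h₁.length_lt_or_break hΔ hper
  have o₂ := h₂.length_lt_or_break hΔ hper
  have o₃ := h₃.length_lt_or_break hΔ hper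
  rcases o₁ with o₁ | o₁ | o₁
  · exact Or.inl o₁
  all_goals
    rcases o₂ with o₂ | o₂ | o₂
    · exact Or.inr (Or.inl o₂)
  all_goals rcases o₃ with o₃ | o₃ | o₃
  all_goals first
    | exact Or.inr (Or.inr o₃)
    | exact (r₁₂ o₁ o₂).elim
    | exact (l₁₂ o₁ o₂).elim
    | exact (r₁₃ o₁ o₃).elim
    | exact (l₁₃ o₁ o₃).elim
    | exact (r₂₃ o₂ o₃).elim
    | exact (l₂₃ o₂ o₃).elim

end IsShiftMatch

/-- A period `p ≤ Δ` of the last `2 * Δ` characters of a `Δ`-periodic window is a period of the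
whole window. -/
theorem period_extend {u : ℤ → α} {W Δ p : ℤ} (hΔ : 1 ≤ Δ) (hp : p ≤ Δ)
    (hper : ∀ x, -W ≤ x → x + Δ < 0 → u x = u (x + Δ)) (hp₀ : 0 ≤ p)
    (hperp : ∀ x, -(2 * Δ) ≤ x → x + p < 0 → u x = u (x + p)) :
    ∀ x, -W ≤ x → x + p < 0 → u x = u (x + p) := by
  have key : ∀ (k : ℕ) (x : ℤ), -x ≤ k → -W ≤ x → x + p < 0 → u x = u (x + p) := by
    intro k
    induction k with
    | zero => intro x hk hx hx'; lia
    | succ k ih =>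
      intro x hk hx hx'
      rcases le_or_gt (-(2 * Δ)) x with h | h
      · exact hperp x h hx'
      · rw [hper x hx (by lia), hper (x + p) (by lia) (by lia),
          ih (x + Δ) (by push_cast at hk; lia) (by lia) (by lia)]
        congr 1
        ring
  exact fun x hx hx' => key (-x).toNat x (by lia) hx hx'

theorem card_le_of_separated {ι : Type*} {M : Finset ι} {δ : ι → ℤ} {Δ : ℤ} {N : ℝ}
    (hΔ : 1 ≤ Δ) (hN : 0 ≤ N) (h₀ : ∀ e ∈ M, 0 ≤ δ e) (hδN : ∀ e ∈ M, (δ e : ℝ) ≤ N)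
    (hinj : Set.InjOn δ M) (hsep : ∀ e ∈ M, ∀ e' ∈ M, δ e < δ e' → Δ ≤ δ e' - δ e) :
    (M.card : ℝ) ≤ N / Δ + 1 := by
  have hΔ' : (0 : ℝ) < Δ := by exact_mod_cast hΔ
  have hle : M.card ≤ (Finset.Icc (0 : ℤ) ⌊N / Δ⌋).card := by
    refine Finset.card_le_card_of_injOn (fun e => δ e / Δ) ?_ ?_
    · intro e he
      simp only [Finset.coe_Icc, Set.mem_Icc]
      refine ⟨Int.ediv_nonneg (h₀ e he) (by lia), Int.le_floor.2 ?_⟩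
      rw [le_div_iff₀ hΔ']
      have : δ e / Δ * Δ ≤ δ e := Int.ediv_mul_le _ (by lia)
      exact le_trans (by exact_mod_cast this) (hδN e he)
    · intro e he e' he' heq
      simp only at heq
      apply hinj he he'
      have h₁ := Int.emod_add_mul_ediv (δ e) Δ
      have h₂ := Int.emod_add_mul_ediv (δ e') Δ
      rw [heq] at h₁
      have h₃ := Int.emod_nonneg (δ e) (show Δ ≠ 0 by lia)
      have h₄ := Int.emod_nonneg (δ e') (show Δ ≠ 0 by lia)
      have h₅ := Int.emod_lt_of_pos (δ e) (show 0 < Δ by lia)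
      have h₆ := Int.emod_lt_of_pos (δ e') (show 0 < Δ by lia)
      rcases lt_trichotomy (δ e) (δ e') with h | h | h
      · have := hsep e he e' he' h
        lia
      · exact h
      · have := hsep e' he' e he h
        lia
  have hfl : 0 ≤ ⌊N / Δ⌋ := Int.floor_nonneg.2 (by positivity)
  have hcard : ((Finset.Icc (0 : ℤ) ⌊N / Δ⌋).card : ℝ) = ⌊N / Δ⌋ + 1 := by
    rw [Int.card_Icc]
    have : (((⌊N / Δ⌋ + 1 - 0).toNat : ℤ) : ℝ) = ((⌊N / Δ⌋ + 1 : ℤ) : ℝ) := by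
      congr 1; lia
    push_cast at this ⊢
    exact this
  have hle' : (M.card : ℝ) ≤ ((Finset.Icc (0 : ℤ) ⌊N / Δ⌋).card : ℝ) := by exact_mod_cast hle
  linarith [Int.floor_le (N / Δ)]

theorem exists_three_close {ι : Type*} {M : Finset ι} {δ : ι → ℤ} {N : ℝ} (hN : 0 < N)
    (h₀ : ∀ e ∈ M, 0 ≤ δ e) (hδN : ∀ e ∈ M, (δ e : ℝ) ≤ N) (hM : 18 < M.card) :
    ∃ e₁ ∈ M, ∃ e₂ ∈ M, ∃ e₃ ∈ M, e₁ ≠ e₂ ∧ e₁ ≠ e₃ ∧ e₂ ≠ e₃ ∧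
      (|δ e₁ - δ e₂| : ℝ) < N / 8 ∧ (|δ e₁ - δ e₃| : ℝ) < N / 8 ∧
      (|δ e₂ - δ e₃| : ℝ) < N / 8 := by
  have hmaps : ∀ e ∈ M, ⌊(δ e : ℝ) / (N / 8)⌋ ∈ Finset.Icc (0 : ℤ) 8 := by
    intro e he
    have h1 : (0 : ℝ) ≤ δ e := by exact_mod_cast h₀ e he
    rw [Finset.mem_Icc]
    refine ⟨Int.floor_nonneg.2 (by positivity), Int.floor_le_iff.2 ?_⟩
    rw [div_lt_iff₀ (by positivity)]
    have := hδN e he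
    push_cast
    linarith
  obtain ⟨y, -, hy⟩ := Finset.exists_lt_card_fiber_of_mul_lt_card_of_maps_to (n := 2) hmaps
    (by simpa using hM)
  obtain ⟨e₁, e₂, e₃, m₁, m₂, m₃, n₁₂, n₁₃, n₂₃⟩ := Finset.two_lt_card_iff.1 hy
  rw [Finset.mem_filter] at m₁ m₂ m₃
  have close : ∀ a b : ι, ⌊(δ a : ℝ) / (N / 8)⌋ = y → ⌊(δ b : ℝ) / (N / 8)⌋ = y →
      (|δ a - δ b| : ℝ) < N / 8 := by
    intro a b ha hb
    have := Int.abs_sub_lt_one_of_floor_eq_floor (ha.trans hb.symm)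
    rwa [← sub_div, abs_div, abs_of_pos (show 0 < N / 8 by positivity),
      div_lt_one (by positivity)] at this
  exact ⟨e₁, m₁.1, e₂, m₂.1, e₃, m₃.1, n₁₂, n₁₃, n₂₃, close _ _ m₁.2 m₂.2,
    close _ _ m₁.2 m₃.2, close _ _ m₂.2 m₃.2⟩

theorem eighteen_le_three_add {q : ℕ} (hq : 3 ≤ q) :
    18 ≤ 3 + 9 * (q : ℝ) / Real.logb 2 (q : ℝ) := by
  have hq' : (3 : ℝ) ≤ q := by exact_mod_cast hq
  have hlog : 0 < Real.log q := Real.log_pos (by linarith)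
  have h2 := Real.log_two_gt_d9
  have he := Real.exp_one_gt_d9
  have h1 := Real.log_le_sub_one_of_pos (show 0 < (q : ℝ) / Real.exp 1 by positivity)
  rw [Real.log_div (by positivity) (by positivity), Real.log_exp] at h1
  have h3 : (q : ℝ) / Real.exp 1 ≤ q / (27 / 10) := by gcongr; linarith
  have h4 : 15 ≤ 9 * (q : ℝ) / Real.logb 2 q := by
    rw [Real.logb, div_div_eq_mul_div, le_div_iff₀ hlog]
    have h5 := mul_le_mul_of_nonneg_left h2.le (show (0 : ℝ) ≤ q by linarith)
    linarith
  linarith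

theorem four_mul_add_one_le {q : ℕ} (hq : 3 ≤ q) {r : ℝ} (hr : 2 ≤ r) (hrq : r ≤ q) :
    4 * r + 1 ≤ (3 + 9 * (q : ℝ) / Real.logb 2 (q : ℝ)) * Real.logb 2 r := by
  have hq' : (3 : ℝ) ≤ q := by exact_mod_cast hq
  have hlq : 0 < Real.logb 2 q := Real.logb_pos (by norm_num) (by linarith)
  have hlr : 1 ≤ Real.logb 2 r := by
    rw [Real.le_logb_iff_rpow_le (by norm_num) (by linarith)]
    simpa using hr
  have h2 := Real.log_two_gt_d9
  have hdiv : Real.logb 2 q - Real.logb 2 r ≤ 2 * (q / r - 1) := by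
    rw [← Real.logb_div (by positivity) (by positivity), Real.logb, div_le_iff₀ (by linarith)]
    have h1 := Real.log_le_sub_one_of_pos (show 0 < (q : ℝ) / r by positivity)
    have h3 : 0 ≤ (q : ℝ) / r - 1 := by
      rw [sub_nonneg, le_div_iff₀ (by linarith)]
      linarith
    nlinarith
  have hmul : r * Real.logb 2 q ≤ r * Real.logb 2 r + 2 * (q - r) := by
    have h1 := mul_le_mul_of_nonneg_left hdiv (show 0 ≤ r by linarith)
    have h3 : r * (2 * ((q : ℝ) / r - 1)) = 2 * (q - r) := by field_simp
    linarith
  have h5 : 4 * r ≤ 9 * (q : ℝ) / Real.logb 2 q * Real.logb 2 r := by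
    rw [div_mul_eq_mul_div, le_div_iff₀ hlq]
    nlinarith
  linarith

theorem card_shiftMatch_le_aux {ι : Type*} {q : ℕ} (hq : 3 ≤ q) (u v : ℤ → α) (δ c b : ι → ℤ)
    (k : ℕ) : ∀ (N : ℝ) (M : Finset ι), 2 ≤ N → N < 2 ^ (k + 2) → Set.InjOn δ M →
      (∀ e ∈ M, IsShiftMatch q u v (δ e) (c e) (b e) ∧ b e ≤ δ e + c e ∧
        ((c e + δ e + b e : ℤ) : ℝ) ≤ N) →
      (M.card : ℝ) ≤ (3 + 9 * (q : ℝ) / Real.logb 2 (q : ℝ)) * Real.logb 2 N := by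
  have hB := eighteen_le_three_add hq
  set B : ℝ := 3 + 9 * (q : ℝ) / Real.logb 2 (q : ℝ) with hBdef
  induction k with
  | zero =>
    intro N M hN hN' hinj hM
    have h1 := card_le_of_separated (M := M) (δ := δ) (Δ := 1) (N := N) le_rfl (by linarith)
      (fun e he => (hM e he).1.shift_nonneg)
      (fun e he => by
        obtain ⟨h, -, h'⟩ := hM e he
        refine le_trans (Int.cast_le.2 ?_) h'
        linarith [h.left_nonneg, h.right_nonneg]) hinj (fun e _ e' _ h => by lia)
    have h2 : 1 ≤ Real.logb 2 N := by
      rw [Real.le_logb_iff_rpow_le (by norm_num) (by linarith)]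
      simpa using hN
    norm_num at h1 hN'
    nlinarith
  | succ k ih =>
    intro N M hN hN' hinj hM
    rcases lt_or_ge N (2 ^ (k + 2)) with hlt | hge
    · exact ih N M hN hlt hinj hM
    have hN4 : 4 ≤ N := by
      have : (1 : ℝ) ≤ 2 ^ k := one_le_pow₀ (by norm_num)
      rw [pow_add] at hge
      linarith
    have hδN : ∀ e ∈ M, (δ e : ℝ) ≤ N := fun e he => by
      obtain ⟨h, -, h'⟩ := hM e he
      refine le_trans (Int.cast_le.2 ?_) h'
      linarith [h.left_nonneg, h.right_nonneg]
    have h₀ : ∀ e ∈ M, 0 ≤ δ e := fun e he => (hM e he).1.shift_nonneg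
    have split : ∀ N' : ℝ, 2 ≤ N' → N' ≤ N / 2 →
        ((M.filter fun e => N' < ((c e + δ e + b e : ℤ) : ℝ)).card : ℝ) ≤
          B * Real.logb 2 (N / N') → (M.card : ℝ) ≤ B * Real.logb 2 N := by
      intro N' h2 hle hcard
      have hlow := ih N' (M.filter fun e => ¬ N' < ((c e + δ e + b e : ℤ) : ℝ)) h2
        (by rw [pow_succ] at hN'; rw [pow_add] at hN' ⊢; linarith)
        (hinj.mono (by exact_mod_cast Finset.filter_subset _ _))
        (fun e he => by
          rw [Finset.mem_filter, not_lt] at he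
          exact ⟨(hM e he.1).1, (hM e he.1).2.1, he.2⟩)
      have hsum := Finset.card_filter_add_card_filter_not (s := M)
        (fun e => N' < ((c e + δ e + b e : ℤ) : ℝ))
      rw [Real.logb_div (by positivity) (by positivity)] at hcard
      have hsum' : ((M.filter fun e => N' < ((c e + δ e + b e : ℤ) : ℝ)).card : ℝ) +
          ((M.filter fun e => ¬ N' < ((c e + δ e + b e : ℤ) : ℝ)).card : ℝ) = M.card := by
        exact_mod_cast hsum
      linarith
    rcases le_or_gt ((M.filter fun e => N / 2 < ((c e + δ e + b e : ℤ) : ℝ)).card : ℝ) B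
      with hsmall | hbig
    · refine split (N / 2) (by linarith) le_rfl ?_
      have : N / (N / 2) = 2 := by field_simp
      rw [this, Real.logb_self_eq_one (by norm_num)]
      linarith
    obtain ⟨e₁, m₁, e₂, m₂, e₃, m₃, n₁₂, n₁₃, n₂₃, g₁₂, g₁₃, g₂₃⟩ := exists_three_close
      (δ := δ) (N := N) (by linarith) (fun e he => h₀ e (Finset.mem_of_mem_filter e he))
      (fun e he => hδN e (Finset.mem_of_mem_filter e he))
      (by exact_mod_cast hB.trans_lt hbig)
    rw [Finset.mem_filter] at m₁ m₂ m₃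
    set W : ℤ := ⌊N / 4⌋ + 1 with hWdef
    have hW : N / 4 < W := by rw [hWdef]; push_cast; exact Int.lt_floor_add_one _
    have hwin : ∀ e ∈ M, N / 2 < ((c e + δ e + b e : ℤ) : ℝ) → W ≤ δ e + c e := by
      intro e he hl
      obtain ⟨-, h, -⟩ := hM e he
      rw [hWdef, Int.add_one_le_iff, Int.floor_lt]
      have : (b e : ℝ) ≤ δ e + c e := by exact_mod_cast h
      push_cast at hl ⊢
      linarith
    have hne : ∀ e ∈ M, ∀ e' ∈ M, e ≠ e' → δ e ≠ δ e' := fun e he e' he' h h' =>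
      h (hinj he he' h')
    obtain ⟨p, hp, hpN, hpper⟩ : ∃ p : ℤ, 1 ≤ p ∧ (p : ℝ) < N / 8 ∧
        ∀ x, -W ≤ x → x + p < 0 → u x = u (x + p) := by
      have habs := abs_lt.1 g₁₂
      rcases lt_or_gt_of_ne (hne e₁ m₁.1 e₂ m₂.1 n₁₂) with h | h
      · exact ⟨δ e₂ - δ e₁, by lia, by push_cast; linarith,
          (hM _ m₁.1).1.period_of_lt (hM _ m₂.1).1 h (hwin _ m₁.1 m₁.2) (hwin _ m₂.1 m₂.2)⟩
      · exact ⟨δ e₁ - δ e₂, by lia, by push_cast; linarith,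
          (hM _ m₂.1).1.period_of_lt (hM _ m₁.1).1 h (hwin _ m₂.1 m₂.2) (hwin _ m₁.1 m₁.2)⟩
    obtain ⟨Δ, ⟨hΔ, hper⟩, hmin⟩ := Int.exists_least_of_bdd
      (P := fun p : ℤ => 1 ≤ p ∧ ∀ x, -W ≤ x → x + p < 0 → u x = u (x + p))
      ⟨1, fun z hz => hz.1⟩ ⟨p, hp, hpper⟩
    have hΔp : (Δ : ℝ) ≤ p := by exact_mod_cast hmin p ⟨hp, hpper⟩
    have hΔ' : (1 : ℝ) ≤ Δ := by exact_mod_cast hΔ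
    have hgap : ∀ e e' : ι, (|δ e - δ e'| : ℝ) < N / 8 → |δ e - δ e'| + Δ ≤ W := by
      intro e e' h
      have : ((|δ e - δ e'| + Δ : ℤ) : ℝ) ≤ (W : ℝ) := by push_cast; linarith
      exact_mod_cast this
    have hN4q : N < 4 * q * Δ := by
      have hlt : ∀ e, N / 2 < ((c e + δ e + b e : ℤ) : ℝ) → c e + δ e + b e < 2 * q * Δ →
          N < 4 * q * Δ := by
        intro e h h'
        have : ((c e + δ e + b e : ℤ) : ℝ) < ((2 * q * Δ : ℤ) : ℝ) := by exact_mod_cast h'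
        push_cast at this h
        linarith
      rcases (hM _ m₁.1).1.exists_length_lt (hM _ m₂.1).1 (hM _ m₃.1).1 hΔ
        (hwin _ m₁.1 m₁.2) (hwin _ m₂.1 m₂.2) (hwin _ m₃.1 m₃.2)
        (hne _ m₁.1 _ m₂.1 n₁₂) (hne _ m₁.1 _ m₃.1 n₁₃) (hne _ m₂.1 _ m₃.1 n₂₃)
        (hgap _ _ g₁₂) (hgap _ _ g₁₃) (hgap _ _ g₂₃) hper with h | h | h
      · exact hlt e₁ m₁.2 h
      · exact hlt e₂ m₂.2 h
      · exact hlt e₃ m₃.2 h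
    refine split (4 * Δ) (by linarith) (by linarith) ?_
    have hwin' : ∀ e ∈ M, 4 * (Δ : ℝ) < ((c e + δ e + b e : ℤ) : ℝ) → 2 * Δ ≤ δ e + c e := by
      intro e he hl
      obtain ⟨-, h, -⟩ := hM e he
      have : 4 * Δ < c e + δ e + b e := by exact_mod_cast hl
      lia
    refine (card_le_of_separated (δ := δ) (Δ := Δ) (N := N) hΔ (by linarith)
      (fun e he => h₀ e (Finset.mem_of_mem_filter e he))
      (fun e he => hδN e (Finset.mem_of_mem_filter e he))
      (hinj.mono (by exact_mod_cast Finset.filter_subset _ _)) ?_).trans ?_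
    · intro e he e' he' hlt
      rw [Finset.mem_filter] at he he'
      by_contra! hcon
      refine hcon.not_ge (hmin _ ⟨by lia, period_extend hΔ hcon.le hper (by lia) ?_⟩)
      exact (hM _ he.1).1.period_of_lt (hM _ he'.1).1 hlt (hwin' _ he.1 he.2)
        (hwin' _ he'.1 he'.2)
    · have hr := four_mul_add_one_le hq (r := N / (4 * Δ))
        (by rw [le_div_iff₀ (by positivity)]; linarith)
        (by rw [div_le_iff₀ (by positivity)]; linarith)
      have : 4 * (N / (4 * Δ)) = N / Δ := by field_simp
      rw [this] at hr
      exact hr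

/-- Matches of length at most `N` with pairwise different shifts: those whose part to the left of
the origin is at least half of the match. -/
theorem card_shiftMatch_le {ι : Type*} {q : ℕ} (hq : 3 ≤ q) (u v : ℤ → α) (δ c b : ι → ℤ)
    {N : ℝ} (hN : 2 ≤ N) {M : Finset ι} (hinj : Set.InjOn δ M)
    (hM : ∀ e ∈ M, IsShiftMatch q u v (δ e) (c e) (b e) ∧ b e ≤ δ e + c e ∧
        ((c e + δ e + b e : ℤ) : ℝ) ≤ N) :
    (M.card : ℝ) ≤ (3 + 9 * (q : ℝ) / Real.logb 2 (q : ℝ)) * Real.logb 2 N := by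
  obtain ⟨k, hk⟩ := pow_unbounded_of_one_lt N (show (1 : ℝ) < 2 by norm_num)
  refine card_shiftMatch_le_aux hq u v δ c b k N M hN (hk.trans_le ?_) hinj hM
  exact pow_le_pow_right₀ (by norm_num) (by lia)

/-- Matches of length at most `N` with pairwise different nonnegative shifts. -/
theorem card_shiftMatch_le_two_mul {ι : Type*} {q : ℕ} (hq : 3 ≤ q) (u v : ℤ → α)
    (δ c b : ι → ℤ) {N : ℝ} (hN : 2 ≤ N) {M : Finset ι} (hinj : Set.InjOn δ M)
    (hM : ∀ e ∈ M, IsShiftMatch q u v (δ e) (c e) (b e) ∧ ((c e + δ e + b e : ℤ) : ℝ) ≤ N) :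
    (M.card : ℝ) ≤ 2 * ((3 + 9 * (q : ℝ) / Real.logb 2 (q : ℝ)) * Real.logb 2 N) := by
  have h₁ := card_shiftMatch_le hq u v δ c b hN (M := M.filter fun e => b e ≤ δ e + c e)
    (hinj.mono (by exact_mod_cast Finset.filter_subset _ _))
    (fun e he => by
      rw [Finset.mem_filter] at he
      exact ⟨(hM e he.1).1, he.2, (hM e he.1).2⟩)
  have h₂ := card_shiftMatch_le hq (fun x => v (-1 - x)) (fun x => u (-1 - x)) δ b c hN
    (M := M.filter fun e => ¬ b e ≤ δ e + c e)
    (hinj.mono (by exact_mod_cast Finset.filter_subset _ _))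
    (fun e he => by
      rw [Finset.mem_filter] at he
      obtain ⟨h, hl⟩ := hM e he.1
      have := h.left_nonneg
      have := h.shift_nonneg
      refine ⟨h.reverse, by lia, ?_⟩
      push_cast at hl ⊢
      linarith)
  have hsum : ((M.filter fun e => b e ≤ δ e + c e).card : ℝ) +
      ((M.filter fun e => ¬ b e ≤ δ e + c e).card : ℝ) = M.card := by
    exact_mod_cast Finset.card_filter_add_card_filter_not (s := M) (fun e => b e ≤ δ e + c e)
  linarith

theorem length_substr (dollar : α) (S : List α) (i j : ℕ) :
    (substr dollar S i j).length = j + 1 - i := by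
  simp [substr]

theorem IsMaximalPair.symm {dollar : α} {S : List α} {n m l : ℕ}
    (h : IsMaximalPair dollar S n m l) : IsMaximalPair dollar S m n l := by
  obtain ⟨h₁, h₂, h₃, h₄, h₅, h₆, h₇, h₈⟩ := h
  exact ⟨h₁, h₃, h₂, h₅, h₄, fun k hk => (h₆ k hk).symm, h₇.symm, h₈.symm⟩

theorem IsMaximalPair.substr_eq {dollar : α} {S : List α} {n m l : ℕ}
    (h : IsMaximalPair dollar S n m l) :
    substr dollar S n (n + l - 1) = substr dollar S m (m + l - 1) := by
  obtain ⟨h₁, h₂, h₃, -, -, h₆, -⟩ := h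
  unfold substr
  rw [show n + l - 1 + 1 - n = l by lia, show m + l - 1 + 1 - m = l by lia]
  exact List.map_congr_left fun k hk => h₆ k (List.mem_range.1 hk)

theorem IsMaximalPair.isShiftMatch {dollar : α} {S : List α} {n m l : ℕ}
    (h : IsMaximalPair dollar S n m l) {q i j : ℕ}
    (hpow : ¬ IsFracPowGe (2 * q) (substr dollar S n (n + l - 1)))
    (hi : n ≤ i ∧ i ≤ n + l) (hj : m ≤ j ∧ j ≤ m + l) (hδ : (j : ℤ) - i ≤ (m : ℤ) - n) :
    IsShiftMatch q (fun x => chr dollar S ((i : ℤ) + x).toNat)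
      (fun x => chr dollar S ((j : ℤ) + x).toNat)
      ((m : ℤ) - n - (j - i)) (j - m) (n + l - i) where
  shift_nonneg := by lia
  left_nonneg := by lia
  right_nonneg := by lia
  eq_shift x hx hx' := by
    have := h.2.2.2.2.2.1 ((i : ℤ) + x - n).toNat (by lia)
    convert this using 2 <;> lia
  lt_of_period Δ hΔ hper := by
    have hl := h.1
    have hlen := length_substr dollar S n (n + l - 1)
    rw [show n + l - 1 + 1 - n = l by lia] at hlen
    rw [IsFracPowGe, not_le, hlen] at hpow
    have hΔper : IsPeriodOf Δ.toNat (substr dollar S n (n + l - 1)) := by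
      refine ⟨by lia, fun k hk => ?_⟩
      rw [hlen] at hk
      simp only [substr, List.get_eq_getElem, List.getElem_map, List.getElem_range]
      have := hper ((n : ℤ) + k - i) (by lia) (by lia)
      convert this using 2 <;> lia
    have hle : minPeriod (substr dollar S n (n + l - 1)) ≤ Δ.toNat := Nat.sInf_le hΔper
    have hlt : l < 2 * q * Δ.toNat := hpow.trans_le (Nat.mul_le_mul_left _ hle)
    have hcast : ((l : ℕ) : ℤ) < ((2 * q * Δ.toNat : ℕ) : ℤ) := by exact_mod_cast hlt
    push_cast at hcast
    rw [Int.toNat_of_nonneg (by lia)] at hcast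
    linarith

theorem IsMaximalPair.start_le {dollar : α} {S : List α} {n m l n' m' l' i : ℕ}
    (h' : IsMaximalPair dollar S n' m' l') (h : IsMaximalPair dollar S n m l)
    (hi : i ≤ n + l) (hi' : n' ≤ i) (hd : (m : ℤ) - n = (m' : ℤ) - n') : n' ≤ n := by
  by_contra! hcon
  have heq := h.2.2.2.2.2.1 (n' - 1 - n) (by lia)
  refine h'.2.2.2.2.2.2.1 ?_
  convert heq using 2 <;> lia

/-- A maximal pair is determined by its shift and a position it touches. -/
theorem IsMaximalPair.eq_of_sub_eq {dollar : α} {S : List α} {n m l n' m' l' i : ℕ}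
    (h : IsMaximalPair dollar S n m l) (h' : IsMaximalPair dollar S n' m' l')
    (hi : n ≤ i ∧ i ≤ n + l) (hi' : n' ≤ i ∧ i ≤ n' + l')
    (hd : (m : ℤ) - n = (m' : ℤ) - n') : n = n' ∧ m = m' ∧ l = l' := by
  have hn : n = n' := le_antisymm (h.start_le h' hi'.2 hi.1 hd.symm) (h'.start_le h hi.2 hi'.1 hd)
  have hm : m = m' := by lia
  subst hn hm
  refine ⟨rfl, rfl, ?_⟩
  rcases lt_trichotomy l l' with hl | hl | hl
  · exact absurd (h'.2.2.2.2.2.1 l hl) h.2.2.2.2.2.2.2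
  · exact hl
  · exact absurd (h.2.2.2.2.2.1 l' hl) h'.2.2.2.2.2.2.2

theorem IsMaximalPair.two_le_length {dollar : α} {S : List α} {n m l : ℕ}
    (h : IsMaximalPair dollar S n m l) : 2 ≤ S.length := by
  obtain ⟨h₁, h₂, h₃, h₄, h₅, -, h₇, -⟩ := h
  have : n ≠ m := by
    rintro rfl
    exact h₇ rfl
  lia

/-- For `q ≥ 3` and indices `i`, `j` of characters in `S$`, there are at most
`12·(1 + 3q/log₂q)·log₂|S|` maximal pairs crossing `i` resp. `j` whose corresponding maximal
repeat is not a fractional power with exponent `≥ 2q`. -/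
theorem maximal_pairs_not_high_power (dollar : α) (S : List α)
    (hdollar : dollar ∉ S)
    (q : ℕ) (hq : 3 ≤ q)
    (i j : ℕ) (hi : 1 ≤ i ∧ i ≤ S.length + 1) (hj : 1 ≤ j ∧ j ≤ S.length + 1)
    (M : Finset (ℕ × ℕ × ℕ))
    (hM : ∀ p ∈ M, IsMaximalPair dollar S p.1 p.2.1 p.2.2 ∧
      ¬ IsFracPowGe (2 * q) (substr dollar S p.1 (p.1 + p.2.2 - 1)) ∧
      (p.1 ≤ i ∧ i ≤ p.1 + p.2.2) ∧
      (p.2.1 ≤ j ∧ j ≤ p.2.1 + p.2.2)) :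
    (M.card : ℝ) ≤ 12 * (1 + 3 * (q : ℝ) / Real.logb 2 (q : ℝ)) * Real.logb 2 (S.length : ℝ) := by
  rcases M.eq_empty_or_nonempty with rfl | ⟨p₀, hp₀⟩
  · have h₁ : 0 ≤ Real.logb 2 (q : ℝ) :=
      Real.logb_nonneg (by norm_num) (by exact_mod_cast (by lia : 1 ≤ q))
    have h₂ : 0 ≤ Real.logb 2 (S.length : ℝ) := by
      rw [Real.logb]
      exact div_nonneg (Real.log_natCast_nonneg _) (Real.log_nonneg (by norm_num))
    rw [Finset.card_empty, Nat.cast_zero]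
    positivity
  have hN : (2 : ℝ) ≤ S.length := by exact_mod_cast (hM p₀ hp₀).1.two_le_length
  have hinj : Set.InjOn (fun p : ℕ × ℕ × ℕ => (p.2.1 : ℤ) - p.1 - (j - i)) M := by
    rintro ⟨n, m, l⟩ hp ⟨n', m', l'⟩ hp' heq
    obtain ⟨h, -, hpi, -⟩ := hM _ hp
    obtain ⟨h', -, hpi', -⟩ := hM _ hp'
    obtain ⟨rfl, rfl, rfl⟩ := h.eq_of_sub_eq h' hpi hpi' (by simpa using heq)
    rfl
  have hle : ∀ p ∈ M, (p.2.2 : ℝ) ≤ S.length := fun p hp => by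
    obtain ⟨⟨-, h₂, -, h₄, -⟩, -⟩ := hM p hp
    exact_mod_cast (by lia : p.2.2 ≤ S.length)
  have h₁ := card_shiftMatch_le_two_mul hq (fun x => chr dollar S ((i : ℤ) + x).toNat)
    (fun x => chr dollar S ((j : ℤ) + x).toNat)
    (fun p : ℕ × ℕ × ℕ => (p.2.1 : ℤ) - p.1 - (j - i)) (fun p => (j : ℤ) - p.2.1)
    (fun p => (p.1 : ℤ) + p.2.2 - i) hN
    (M := M.filter fun p => (j : ℤ) - i ≤ (p.2.1 : ℤ) - p.1)
    (hinj.mono (by exact_mod_cast Finset.filter_subset _ _))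
    (fun p hp => by
      rw [Finset.mem_filter] at hp
      obtain ⟨h, hpow, hpi, hpj⟩ := hM p hp.1
      refine ⟨h.isShiftMatch hpow hpi hpj hp.2, le_of_eq_of_le ?_ (hle p hp.1)⟩
      push_cast
      ring)
  have h₂ := card_shiftMatch_le_two_mul hq (fun x => chr dollar S ((j : ℤ) + x).toNat)
    (fun x => chr dollar S ((i : ℤ) + x).toNat)
    (fun p : ℕ × ℕ × ℕ => (p.1 : ℤ) - p.2.1 - (i - j)) (fun p => (i : ℤ) - p.1)
    (fun p => (p.2.1 : ℤ) + p.2.2 - j) hN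
    (M := M.filter fun p => ¬ (j : ℤ) - i ≤ (p.2.1 : ℤ) - p.1)
    (fun p hp p' hp' heq => hinj (Finset.mem_of_mem_filter p hp)
      (Finset.mem_of_mem_filter p' hp') (by simp only at heq ⊢; linarith))
    (fun p hp => by
      rw [Finset.mem_filter] at hp
      obtain ⟨h, hpow, hpi, hpj⟩ := hM p hp.1
      rw [h.substr_eq] at hpow
      refine ⟨h.symm.isShiftMatch hpow hpj hpi (by lia), le_of_eq_of_le ?_ (hle p hp.1)⟩
      push_cast
      ring)
  have hsum : ((M.filter fun p => (j : ℤ) - i ≤ (p.2.1 : ℤ) - p.1).card : ℝ) +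
      ((M.filter fun p => ¬ (j : ℤ) - i ≤ (p.2.1 : ℤ) - p.1).card : ℝ) = M.card := by
    exact_mod_cast Finset.card_filter_add_card_filter_not (s := M)
      (fun p => (j : ℤ) - i ≤ (p.2.1 : ℤ) - p.1)
  calc (M.card : ℝ)
      ≤ 4 * ((3 + 9 * (q : ℝ) / Real.logb 2 (q : ℝ)) * Real.logb 2 (S.length : ℝ)) := by
        linarith
    _ = 12 * (1 + 3 * (q : ℝ) / Real.logb 2 (q : ℝ)) * Real.logb 2 (S.length : ℝ) := by ring
end

section
/- For any nonempty string T, the number of distinct primitive strings u such that u² is a suffix of T is at most 2·⌊log₂|T|⌋. -/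
variable {α : Type*}

theorem Primitive.reverse {u : List α} (hu : Primitive u) : Primitive u.reverse := by
  intro v k hk h
  apply hu v.reverse k hk
  rw [← List.reverse_reverse u, h]
  simp [List.reverse_flatten]

theorem Primitive.ne_nil {u : List α} (hu : Primitive u) : u ≠ [] := by
  rintro rfl
  exact hu [] 2 le_rfl (by simp)

/-- A string whose length is `k` times one of its periods `g` is a `k`-th power. -/
theorem List.HasPeriod.eq_flatten_replicate {g k : ℕ} {u : List α} (h : u.HasPeriod g)
    (hlen : u.length = k * g) : u = (List.replicate k (u.take g)).flatten := by
  induction k generalizing u with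
  | zero => simpa using hlen
  | succ k ih =>
    have hdrop : (u.drop g).length = k * g := by
      rw [List.length_drop, hlen, Nat.succ_mul, Nat.add_sub_cancel]
    have htake : k ≠ 0 → (u.drop g).take g = u.take g := by
      intro hk
      have : g ≤ k * g := Nat.le_mul_of_pos_left g (Nat.pos_of_ne_zero hk)
      refine (List.prefix_of_prefix_length_le ((List.take_prefix _ _).trans (h.drop_prefix g))
        (List.take_prefix _ _) ?_).eq_of_length ?_
      all_goals
        simp only [List.length_take, hdrop, hlen, Nat.succ_mul]
        omega
    have := ih (h.infix (List.drop_suffix g u).isInfix) hdrop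
    rw [List.replicate_succ, List.flatten_cons]
    conv_lhs => rw [← List.take_append_drop g u, this]
    rcases eq_or_ne k 0 with rfl | hk
    · simp
    · rw [htake hk]

/-- A period of a primitive string that divides its length equals its length. -/
theorem Primitive.length_le_of_hasPeriod {g : ℕ} {u : List α} (hu : Primitive u)
    (h : u.HasPeriod g) (hg : g ∣ u.length) : u.length ≤ g := by
  obtain ⟨k, hk⟩ := hg
  rw [Nat.mul_comm] at hk
  by_contra hlt
  have h2 : 2 ≤ k := by
    by_contra hk2
    have : k * g ≤ 1 * g := Nat.mul_le_mul_right g (by omega)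
    omega
  exact hu _ k h2 (h.eq_flatten_replicate hk)

/-- Among three square prefixes of a string with increasing roots, the shortest root being
primitive, the longest root is at least twice as long as the shortest. -/
theorem Primitive.two_mul_length_le {T u v w : List α} (hu : Primitive u)
    (hU : u ++ u <+: T) (hV : v ++ v <+: T) (hW : w ++ w <+: T)
    (huv : u.length < v.length) (hvw : v.length < w.length) : 2 * u.length ≤ w.length := by
  by_contra! hlt
  have root : ∀ {x : List α}, x ++ x <+: T → ∀ i < x.length, x[i]? = T[i]? := by
    rintro x ⟨t, rfl⟩ i hi
    grind
  have square : ∀ {x : List α}, x ++ x <+: T → ∀ i < x.length, T[i]? = T[i + x.length]? := by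
    rintro x ⟨t, rfl⟩ i hi
    grind
  have ru := root hU
  have rv := root hV
  have su := square hU
  have sv := square hV
  have sw := square hW
  have hpre : u <+: v := List.prefix_of_prefix_length_le
    ((List.prefix_append u u).trans hU) ((List.prefix_append v v).trans hV) huv.le
  obtain ⟨a, ha⟩ := Nat.exists_eq_add_of_lt huv
  obtain ⟨b, hb⟩ := Nat.exists_eq_add_of_lt hvw
  have per_u_a : u.HasPeriod (a + 1) := by
    rw [List.hasPeriod_iff_getElem?]
    intro i hi
    rw [ru i (by omega), ru (i + (a + 1)) (by omega), sv i (by omega),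
      su (i + (a + 1)) (by omega)]
    congr 1; omega
  have per_v_b : v.HasPeriod (b + 1) := by
    rw [List.hasPeriod_iff_getElem?]
    intro i hi
    rw [rv i (by omega), rv (i + (b + 1)) (by omega), sw i (by omega),
      sv (i + (b + 1)) (by omega)]
    congr 1; omega
  have per_v_u : v.HasPeriod u.length := by
    rw [List.hasPeriod_iff_getElem?]
    intro i hi
    rw [rv i (by omega), rv (i + u.length) (by omega), su i (by omega)]
  have per_u_g := per_u_a.gcd (per_v_b.infix hpre.isInfix) (by omega)
  set g := (a + 1).gcd (b + 1)
  have hg : 0 < g := Nat.gcd_pos_of_pos_left _ (Nat.succ_pos a)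
  have hga : g ≤ a + 1 := Nat.gcd_le_left _ (Nat.succ_pos a)
  have per_v_g : v.HasPeriod g := by
    rw [List.hasPeriod_iff_forall_getElem?_mod] at per_u_g per_v_b ⊢
    intro i hi
    have hib : i % (b + 1) < u.length := (Nat.mod_lt _ (Nat.succ_pos b)).trans (by omega)
    have hig : i % g ≤ i := Nat.mod_le _ _
    have hig' : i % g < u.length := (Nat.mod_lt _ hg).trans (by omega)
    rw [per_v_b i hi, rv _ (by omega), ← ru _ hib, per_u_g _ hib,
      Nat.mod_mod_of_dvd _ (Nat.gcd_dvd_right _ _), rv _ (by omega), ru _ hig']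
  have per_u := (per_v_u.gcd per_v_g (by omega)).infix hpre.isInfix
  have hle := hu.length_le_of_hasPeriod per_u (Nat.gcd_dvd_left _ _)
  have : u.length.gcd g ≤ g := Nat.gcd_le_right _ hg
  omega

/-- A set of positive integers at most `N / 2`, in which elements double every two steps,
has at most `2 * log₂ N` elements. -/
theorem Finset.card_le_two_mul_log {N : ℕ} {S : Finset ℕ} (hpos : ∀ x ∈ S, 0 < x)
    (hle : ∀ x ∈ S, 2 * x ≤ N)
    (hgap : ∀ x ∈ S, ∀ y ∈ S, ∀ z ∈ S, x < y → y < z → 2 * x ≤ z) :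
    S.card ≤ 2 * Nat.log 2 N := by
  induction N using Nat.strong_induction_on generalizing S with
  | _ N ih =>
  rcases S.eq_empty_or_nonempty with rfl | hS
  · simp
  have hc := S.max'_mem hS
  have hN : 2 ≤ N := by
    have := hpos _ hc
    have := hle _ hc
    omega
  rw [Nat.log_of_one_lt_of_le one_lt_two hN]
  rcases (S.erase (S.max' hS)).eq_empty_or_nonempty with hR | hR
  · have := Finset.card_erase_of_mem hc
    rw [hR, Finset.card_empty] at this
    omega
  set c := S.max' hS
  set b := (S.erase c).max' hR
  have hb : b ∈ S.erase c := Finset.max'_mem _ hR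
  have hbS := Finset.mem_of_mem_erase hb
  have hbc : b < c := lt_of_le_of_ne (S.le_max' _ hbS) (Finset.ne_of_mem_erase hb)
  have hsub : ∀ x ∈ (S.erase c).erase b, x ∈ S := fun x hx =>
    Finset.mem_of_mem_erase (Finset.mem_of_mem_erase hx)
  have key := ih (N / 2) (by omega) (S := (S.erase c).erase b)
    (fun x hx => hpos x (hsub x hx))
    (fun x hx => by
      have hxb : x < b := lt_of_le_of_ne
        (Finset.le_max' _ _ (Finset.mem_of_mem_erase hx)) (Finset.ne_of_mem_erase hx)
      have := hgap x (hsub x hx) b hbS c hc hxb hbc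
      have := hle c hc
      omega)
    (fun x hx y hy z hz => hgap x (hsub x hx) y (hsub y hy) z (hsub z hz))
  rw [Finset.card_erase_of_mem hb, Finset.card_erase_of_mem hc] at key
  omega

/-- A nonempty string `T` has at most `2·⌊log₂|T|⌋` distinct primitive
square suffixes. -/
theorem primitive_square_suffixes_bound (T : List α) (hT : T ≠ [])
    (U : Finset (List α)) (hU : ∀ u ∈ U, Primitive u ∧ u ++ u <:+ T) :
    U.card ≤ 2 * Nat.log 2 T.length := by
  have hsuf : ∀ u ∈ U, u <:+ T := fun u hu => (List.suffix_append u u).trans (hU u hu).2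
  have hinj : Set.InjOn List.length (U : Set (List α)) := fun u hu v hv h =>
    (List.suffix_of_suffix_length_le (hsuf u hu) (hsuf v hv) h.le).eq_of_length h
  have hpre : ∀ u ∈ U, u.reverse ++ u.reverse <+: T.reverse := fun u hu => by
    simpa using List.reverse_prefix.mpr (hU u hu).2
  classical
  rw [← Finset.card_image_of_injOn hinj]
  apply Finset.card_le_two_mul_log
  · simp only [Finset.forall_mem_image]
    exact fun u hu => List.length_pos_of_ne_nil (hU u hu).1.ne_nil
  · simp only [Finset.forall_mem_image]
    intro u hu
    have := (hU u hu).2.length_le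
    rw [List.length_append] at this
    omega
  · simp only [Finset.forall_mem_image]
    intro u hu v hv w hw huv hvw
    simpa using (hU u hu).1.reverse.two_mul_length_le (hpre u hu) (hpre v hv) (hpre w hw)
      (by simpa using huv) (by simpa using hvw)
end

section
/- Let S be a string and let i be an index of a character in S$. Then there are at most 4·⌊log₂|S|⌋ pairwise substantially different padded maximal periodic extensions (l−1, r+1) of occurrences S[l..r] that are fractional powers with exponent ≥ 4, such that l−1 < i ≤ r+1. -/
variable {α : Type*}

/-- `f` is `p`-periodic on the integer interval `[l, r]`. -/
def PeriodicOn (f : ℕ → α) (p l r : ℕ) : Prop :=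
  ∀ k, l ≤ k → k + p ≤ r → f k = f (k + p)

theorem isPeriodOf_substr_iff (dollar : α) (S : List α) (p l r : ℕ) :
    IsPeriodOf p (substr dollar S l r) ↔ 1 ≤ p ∧ PeriodicOn (chr dollar S) p l r := by
  unfold IsPeriodOf PeriodicOn substr
  refine and_congr_right fun _ => ⟨fun h k hl hr => ?_, fun h k hk => ?_⟩
  · have := h (k - l) (by simp; omega)
    simp only [List.get_eq_getElem, List.getElem_map, List.getElem_range] at this
    rwa [show l + (k - l) = k by omega, show l + (k - l + p) = k + p by omega] at this
  · simp only [List.length_map, List.length_range] at hk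
    simp only [List.get_eq_getElem, List.getElem_map, List.getElem_range]
    rw [h (l + k) (by omega) (by omega), Nat.add_assoc]

theorem PeriodicOn.mono {f : ℕ → α} {p l r l' r' : ℕ} (h : PeriodicOn f p l r)
    (hl : l ≤ l') (hr : r' ≤ r) : PeriodicOn f p l' r' :=
  fun k hk hk' => h k (hl.trans hk) (hk'.trans hr)

theorem PeriodicOn.sub {f : ℕ → α} {p q l r : ℕ} (hp : PeriodicOn f p l r)
    (hq : PeriodicOn f q l r) (hpq : p ≤ q) (hlen : l + p + q ≤ r + 1) :
    PeriodicOn f (q - p) l r := by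
  intro k hl hr
  by_cases h : k + q ≤ r
  · rw [hq k hl h, hp (k + (q - p)) (by omega) (by omega)]
    congr 1
    omega
  · have h₁ := hp (k - p) (by omega) (by omega)
    have h₂ := hq (k - p) (by omega) (by omega)
    rw [show k - p + p = k by omega] at h₁
    rw [show k - p + q = k + (q - p) by omega] at h₂
    exact h₁.symm.trans h₂

/-- A weak form of the Fine–Wilf periodicity lemma. -/
theorem PeriodicOn.gcd {f : ℕ → α} {l r : ℕ} (p q : ℕ) (hp : PeriodicOn f p l r)
    (hq : PeriodicOn f q l r) (hlen : l + p + q ≤ r + 1) :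
    PeriodicOn f (p.gcd q) l r := by
  induction hn : p + q using Nat.strong_induction_on generalizing p q with
  | _ n ih =>
    rcases Nat.eq_zero_or_pos p with rfl | hp0
    · simpa using hq
    rcases Nat.eq_zero_or_pos q with rfl | hq0
    · simpa using hp
    rcases le_total p q with h | h
    · have := ih (p + (q - p)) (by omega) p (q - p) hp (hp.sub hq h hlen) (by omega) rfl
      rwa [Nat.gcd_sub_self_right h] at this
    · have := ih (p - q + q) (by omega) (p - q) q (hq.sub hp h (by omega)) hq (by omega) rfl
      rwa [Nat.gcd_sub_self_left h] at this

/-- A period `d` of a window of length at least `p + d` propagates along a `p`-periodic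
interval. -/
theorem PeriodicOn.extend {f : ℕ → α} {d p a b l r : ℕ} (hd : PeriodicOn f d a b)
    (hp : PeriodicOn f p l r) (hp0 : 1 ≤ p) (hla : l ≤ a) (hbr : b ≤ r)
    (hlen : a + p + d ≤ b + 1) : PeriodicOn f d l r := by
  have hright : PeriodicOn f d a r := by
    intro k
    induction k using Nat.strong_induction_on with
    | _ k ih =>
      intro hk hkr
      by_cases h : k + d ≤ b
      · exact hd k hk h
      · have h₁ := hp (k - p) (by omega) (by omega)
        have h₂ := hp (k - p + d) (by omega) (by omega)
        have h₃ := ih (k - p) (by omega) (by omega) (by omega)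
        rw [show k - p + p = k by omega] at h₁
        rw [show k - p + d + p = k + d by omega] at h₂
        rw [← h₁, ← h₂, h₃]
  intro k
  induction hn : a - k using Nat.strong_induction_on generalizing k with
  | _ n ih =>
    intro hk hkr
    by_cases h : a ≤ k
    · exact hright k h hkr
    · have h₁ := hp k (by omega) (by omega)
      have h₂ := hp (k + d) (by omega) (by omega)
      have h₃ := ih (a - (k + p)) (by omega) (k + p) rfl (by omega) (by omega)
      rw [h₁, h₂, h₃]
      congr 1
      omega

theorem PeriodicOn.union {f : ℕ → α} {p l r l' r' : ℕ} (h : PeriodicOn f p l r)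
    (h' : PeriodicOn f p l' r') (hov : l' + p ≤ r + 1) : PeriodicOn f p l r' := by
  intro k hk hkr
  by_cases hc : k + p ≤ r
  · exact h k hk hc
  · exact h' k (by omega) hkr

/-- `[l, r]` is a run of `f` with minimal period `p`: it is not extendable `p`-periodically. -/
structure IsRun (f : ℕ → α) (p l r : ℕ) : Prop where
  one_le_left : 1 ≤ l
  one_le : 1 ≤ p
  periodic : PeriodicOn f p l r
  minimal : ∀ d, 1 ≤ d → PeriodicOn f d l r → p ≤ d
  left_max : ¬ PeriodicOn f p (l - 1) r
  right_max : ¬ PeriodicOn f p l (r + 1)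

theorem IsMaxPerExt.isRun {dollar : α} {S : List α} {l r : ℕ}
    (h : IsMaxPerExt dollar S (minPeriod (substr dollar S l r)) l r l r) :
    IsRun (chr dollar S) (minPeriod (substr dollar S l r)) l r := by
  obtain ⟨h1, -, -, -, -, -, hper, hleft, hright⟩ := h
  rw [isPeriodOf_substr_iff] at hper hleft hright
  exact ⟨h1, hper.1, hper.2,
    fun d hd hd' => Nat.sInf_le ((isPeriodOf_substr_iff dollar S d l r).2 ⟨hd, hd'⟩),
    fun h => hleft ⟨hper.1, h⟩, fun h => hright ⟨hper.1, h⟩⟩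

theorem IsRun.left_le {f : ℕ → α} {p l r l' r' : ℕ} (h : IsRun f p l r)
    (h' : PeriodicOn f p l' r') (hov : l + p ≤ r' + 1) : l ≤ l' := by
  by_contra! hlt
  exact h.left_max ((h'.union h.periodic hov).mono (by omega) le_rfl)

theorem IsRun.le_right {f : ℕ → α} {p l r l' r' : ℕ} (h : IsRun f p l r)
    (h' : PeriodicOn f p l' r') (hov : l' + p ≤ r + 1) : r' ≤ r := by
  by_contra! hlt
  exact h.right_max ((h.periodic.union h' hov).mono le_rfl (by omega))

/-- Two runs with an overlap of at least the sum of their minimal periods coincide. -/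
theorem IsRun.eq_of_overlap {f : ℕ → α} {p l r q l' r' : ℕ} (h : IsRun f p l r)
    (h' : IsRun f q l' r') (hov : max l l' + p + q ≤ min r r' + 1) : l = l' ∧ r = r' := by
  have hp := h.one_le
  have hg := (h.periodic.mono (le_max_left l l') (min_le_left r r')).gcd p q
    (h'.periodic.mono (le_max_right l l') (min_le_right r r')) hov
  have hg0 : 1 ≤ p.gcd q := Nat.gcd_pos_of_pos_left q h.one_le
  have hgp : p.gcd q ≤ p := Nat.gcd_le_left q h.one_le
  have hgq : p.gcd q ≤ q := Nat.gcd_le_right p h'.one_le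
  have hp' := h.minimal _ hg0 (hg.extend h.periodic h.one_le (le_max_left l l')
    (min_le_left r r') (by omega))
  have hq' := h'.minimal _ hg0 (hg.extend h'.periodic h'.one_le (le_max_right l l')
    (min_le_right r r') (by omega))
  obtain rfl : p = q := by omega
  exact ⟨le_antisymm (h.left_le h'.periodic (by omega)) (h'.left_le h.periodic (by omega)),
    le_antisymm (h'.le_right h.periodic (by omega)) (h.le_right h'.periodic (by omega))⟩

/-- Among runs of exponent at least `4` with periods in `[P, 2P)`, distinct ones have distinct left
ends, and the first overlaps the later one in fewer positions than the sum of their periods. -/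
theorem IsRun.overlap_lt {f : ℕ → α} {p l r q l' r' P : ℕ} (h : IsRun f p l r)
    (h' : IsRun f q l' r') (hne : (l, r) ≠ (l', r')) (hle : l ≤ l')
    (hp : 4 * p + l ≤ r + 1) (hq : 4 * q + l' ≤ r' + 1)
    (hp₁ : P ≤ p) (hp₂ : p < 2 * P) (hq₁ : P ≤ q) (hq₂ : q < 2 * P) :
    l < l' ∧ r + 1 < l' + p + q := by
  have key : ¬ max l l' + p + q ≤ min r r' + 1 := fun hov =>
    hne (Prod.ext_iff.2 (h.eq_of_overlap h' hov))
  omega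

/-- A position is touched by at most three runs of exponent at least `4` whose minimal periods
lie in `[P, 2P)`. -/
theorem card_runs_le_three {f : ℕ → α} {i P : ℕ} (E : Finset (ℕ × ℕ)) (p : ℕ × ℕ → ℕ)
    (hE : ∀ e ∈ E, IsRun f (p e) (e.1 + 1) (e.2 - 1) ∧ 4 * p e + e.1 + 1 ≤ e.2 ∧
      e.1 < i ∧ i ≤ e.2 ∧ P ≤ p e ∧ p e < 2 * P) : E.card ≤ 3 := by
  by_contra! hcard
  have key : ∀ e ∈ E, ∀ e' ∈ E, e ≠ e' → e.1 ≤ e'.1 →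
      e.1 < e'.1 ∧ e.2 < e'.1 + 1 + p e + p e' := by
    rintro e he e' he' hne hle
    obtain ⟨h, hlen, -, -, h₁, h₂⟩ := hE e he
    obtain ⟨h', hlen', -, -, h₁', h₂'⟩ := hE e' he'
    have := h.overlap_lt h' (P := P)
      (fun heq => hne (by rw [Prod.mk.injEq] at heq; ext <;> omega))
      (by omega) (by omega) (by omega) h₁ h₂ h₁' h₂'
    omega
  have hinj : Set.InjOn Prod.fst (E : Set (ℕ × ℕ)) := by
    intro e he e' he' heq
    by_contra hne
    exact (key e he e' he' hne heq.le).1.ne heq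
  have hcard' : 4 ≤ (E.image Prod.fst).card := by
    rw [Finset.card_image_of_injOn hinj]
    exact hcard
  have hex : ∀ j : Fin 4, ∃ e ∈ E, e.1 = (E.image Prod.fst).orderEmbOfCardLe hcard' j :=
    fun j => Finset.mem_image.1 (Finset.orderEmbOfCardLe_mem _ hcard' j)
  choose x hx hx' using hex
  have step : ∀ j k : Fin 4, j < k → (x j).2 < (x k).1 + 1 + p (x j) + p (x k) := by
    intro j k hjk
    have hlt : (x j).1 < (x k).1 := by
      rw [hx', hx']
      exact (OrderEmbedding.lt_iff_lt _).2 hjk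
    exact (key _ (hx j) _ (hx k) (fun heq => by rw [heq] at hlt; exact hlt.false) hlt.le).2
  have s₁ := step 0 1 (by decide)
  have s₂ := step 1 2 (by decide)
  have s₃ := step 2 3 (by decide)
  obtain ⟨-, -, -, _, _, _⟩ := hE _ (hx 0)
  obtain ⟨-, _, -, -, _, _⟩ := hE _ (hx 1)
  obtain ⟨-, _, -, -, _, _⟩ := hE _ (hx 2)
  obtain ⟨-, -, _, -, _, _⟩ := hE _ (hx 3)
  omega

/-- For an index `i` of a character in `S$` there are at most
`4·⌊log₂|S|⌋` pairwise substantially different padded maximal periodic extensions `(l-1, r+1)`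
of occurrences `S[l..r]` that are fractional powers with exponent `≥ 4`, with `l-1 < i ≤ r+1`. -/
theorem padded_extensions_of_fourth_powers_bound [DecidableEq α] (dollar : α) (S : List α)
    (hdollar : dollar ∉ S)
    (i : ℕ) (hi : 1 ≤ i ∧ i ≤ S.length + 1)
    (E : Finset (ℕ × ℕ))
    (hE : ∀ e ∈ E, ∃ l r : ℕ, e = (l - 1, r + 1) ∧
      IsFracPowGe 4 (substr dollar S l r) ∧
      IsMaxPerExt dollar S (minPeriod (substr dollar S l r)) l r l r ∧
      l - 1 < i ∧ i ≤ r + 1)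
    (hdiff : ∀ e ∈ E, ∀ e' ∈ E, e ≠ e' →
      substr dollar S e.1 e.2 ≠ substr dollar S e'.1 e'.2) :
    E.card ≤ 4 * Nat.log 2 S.length := by
  set p : ℕ × ℕ → ℕ := fun e => minPeriod (substr dollar S (e.1 + 1) (e.2 - 1)) with hp
  have hrun : ∀ e ∈ E, IsRun (chr dollar S) (p e) (e.1 + 1) (e.2 - 1) ∧
      4 * p e + e.1 + 1 ≤ e.2 ∧ e.1 < i ∧ i ≤ e.2 ∧ 4 * p e ≤ S.length := by
    intro e he
    obtain ⟨l, r, rfl, hpow, hmax, hli, hir⟩ := hE e he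
    have hl := hmax.1
    have hlr := hmax.2.2.1
    have hrS := hmax.2.2.2.2.1
    have hlen : (substr dollar S l r).length = r + 1 - l := by simp [substr]
    simp only [IsFracPowGe, hlen] at hpow
    simp only [hp, Nat.sub_add_cancel hl, Nat.add_sub_cancel]
    exact ⟨hmax.isRun, by omega, hli, hir, by omega⟩
  have hmaps : ∀ e ∈ E, Nat.log 2 (p e) ∈ Finset.range (Nat.log 2 S.length) := by
    intro e he
    obtain ⟨h, -, -, -, hS⟩ := hrun e he
    have hpos := h.one_le
    rw [Finset.mem_range, ← Nat.succ_le_iff, Nat.succ_eq_add_one,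
      ← Nat.log_mul_base one_lt_two (by omega)]
    exact Nat.log_mono_right (by omega)
  have hfib : ∀ k ∈ Finset.range (Nat.log 2 S.length),
      (E.filter fun e => Nat.log 2 (p e) = k).card ≤ 4 := by
    intro k _
    refine (card_runs_le_three (f := chr dollar S) (i := i) (P := 2 ^ k) _ p ?_).trans
      (by norm_num)
    intro e he
    obtain ⟨heE, rfl⟩ := Finset.mem_filter.1 he
    obtain ⟨h, hlen, hl, hr, -⟩ := hrun e heE
    have hpos := h.one_le
    have := Nat.lt_pow_succ_log_self one_lt_two (p e)
    exact ⟨h, hlen, hl, hr, Nat.pow_log_le_self 2 (by omega), by rwa [pow_succ'] at this⟩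
  simpa using Finset.card_le_mul_card_image_of_maps_to hmaps 4 hfib
end

section
/- Let S be a string and let i ≥ 2 be an index at which a new run starts in the Burrows–Wheeler transform of S, i.e., S[π_{i−1}] ≠ S[π_i]. Then the suffix S[π_{i−1}+1..|S|+1] is lexicographically strictly smaller than S[π_i+1..|S|+1]; and if m denotes the position of their first mismatch, then m ≥ 2 implies that (π_{i−1}+1, π_i+1, m−1) is a maximal pair of S. -/
variable {α : Type*}

theorem List.Lex.rel_of_first_mismatch {β : Type*} {r : β → β → Prop} [Std.Irrefl r]
    {l₁ l₂ : List β} (h : List.Lex r l₁ l₂) {n : ℕ} {x y : β}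
    (heq : ∀ j < n, l₁[j]? = l₂[j]?)
    (hx : l₁[n]? = some x) (hy : l₂[n]? = some y) (hxy : x ≠ y) : r x y := by
  induction h generalizing n with
  | nil => simp at hx
  | cons h ih =>
    cases n with
    | zero => simp_all
    | succ n =>
      refine ih (n := n) (fun j hj => ?_) (by simpa using hx) (by simpa using hy)
      simpa using heq (j + 1) (by omega)
  | rel h =>
    cases n with
    | zero => simp_all
    | succ n =>
      have h0 := heq 0 (by omega)
      simp only [List.getElem?_cons_zero, Option.some.injEq] at h0
      subst h0
      exact absurd h (irrefl _)

theorem chr_mem (dollar : α) (S : List α) {j : ℕ} (h₁ : 1 ≤ j) (h₂ : j ≤ S.length) :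
    chr dollar S j ∈ S := by
  rw [chr, dif_pos ⟨h₁, h₂⟩]
  exact List.get_mem ..

theorem chr_length_succ (dollar : α) (S : List α) :
    chr dollar S (S.length + 1) = dollar :=
  dif_neg (by omega)

theorem rot_getElem? (dollar : α) (S : List α) {k j : ℕ} (h : k + j ≤ S.length) :
    (rot dollar S k)[j]? = some (chr dollar S (k + (j + 1))) := by
  rw [rot, List.getElem?_append_left (by simp; omega), List.getElem?_drop]
  rcases h.lt_or_eq with h | h
  · rw [List.getElem?_append_left h, chr, dif_pos (by omega), List.getElem?_eq_getElem h]
    rfl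
  · rw [← add_assoc, h, chr_length_succ, List.getElem?_concat_length]

/-- A common prefix of two distinct suffixes of `S` followed by `dollar` does not reach the sentinel. -/
theorem add_le_length_succ_of_agree {dollar : α} {S : List α} (hdollar : dollar ∉ S)
    {a b m : ℕ} (hb : b ≤ S.length) (hab : a < b)
    (heq : ∀ k, 1 ≤ k → k < m → chr dollar S (a + k) = chr dollar S (b + k)) :
    b + m ≤ S.length + 1 := by
  by_contra! hlt
  have h := heq (S.length + 1 - b) (by omega) (by omega)
  rw [Nat.add_sub_cancel' (by omega : b ≤ S.length + 1), chr_length_succ] at h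
  exact hdollar (h ▸ chr_mem dollar S (by omega) (by omega))

/-- If a new run starts at index `i ≥ 2` of the Burrows–Wheeler transform
of `S` (i.e. `S[π_{i-1}] ≠ S[π_i]`), then the suffix `S[π_{i-1}+1..|S|+1]` is lexicographically
strictly smaller than `S[π_i+1..|S|+1]` (at the first mismatch `m`, the character of the
former is smaller), and if `m ≥ 2` then `(π_{i-1}+1, π_i+1, m-1)` is a maximal pair of `S`. -/
theorem run_boundary_gives_maximal_pair [LinearOrder α] (dollar : α) (S : List α)
    (hdollar : dollar ∉ S)
    (π : ℕ → ℕ) (hπ : IsBWTPerm dollar S π)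
    (i : ℕ) (hi : 2 ≤ i ∧ i ≤ S.length + 1)
    (hrun : chr dollar S (π (i - 1)) ≠ chr dollar S (π i))
    (m : ℕ) (hm : 1 ≤ m)
    (hfirst : ∀ k, 1 ≤ k → k < m → chr dollar S (π (i - 1) + k) = chr dollar S (π i + k))
    (hmis : chr dollar S (π (i - 1) + m) ≠ chr dollar S (π i + m)) :
    chr dollar S (π (i - 1) + m) < chr dollar S (π i + m) ∧
    (2 ≤ m → IsMaximalPair dollar S (π (i - 1) + 1) (π i + 1) (m - 1)) := by
  have ha := hπ.1 (i - 1) (by omega) (by omega)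
  have hb := hπ.1 i (by omega) hi.2
  have hlex := hπ.2 (i - 1) i (by omega) (by omega) hi.2
  generalize π (i - 1) = a at *
  generalize π i = b at *
  have hbound : a + m ≤ S.length + 1 ∧ b + m ≤ S.length + 1 := by
    rcases lt_trichotomy a b with h | h | h
    · have := add_le_length_succ_of_agree hdollar hb h hfirst
      omega
    · exact absurd (congrArg (chr dollar S) h) hrun
    · have := add_le_length_succ_of_agree hdollar ha h
        fun k h₁ h₂ => (hfirst k h₁ h₂).symm
      omega
  obtain ⟨m, rfl⟩ : ∃ m', m = m' + 1 := ⟨m - 1, by omega⟩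
  refine ⟨hlex.rel_of_first_mismatch (n := m) (fun j hj => ?_)
    (rot_getElem? dollar S (by omega)) (rot_getElem? dollar S (by omega)) hmis, fun h2 => ?_⟩
  · rw [rot_getElem? dollar S (by omega), rot_getElem? dollar S (by omega),
      hfirst (j + 1) (by omega) (by omega)]
  · refine ⟨by omega, by omega, by omega, by omega, by omega, fun k hk => ?_, hrun, ?_⟩
    · simpa only [add_assoc, add_comm 1 k] using hfirst (k + 1) (by omega) (by omega)
    · simpa only [Nat.add_sub_cancel, add_assoc, add_comm 1 m] using hmis
end
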